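/- Let n ≥ 3 be odd. Let s : Fin n → (Fin 2 → Fin 2) be a strategy having at least one constant component and not saturating GYNI_n, and let s' be its evaluation. Then P_s − P_{[s']} lies in the real linear span of { P_u : u a strategy saturating GYNI_n }, where [s'] denotes the constant strategy of the string s'. -/

import Mathlib

noncomputable section

/-- Cyclic successor on `Fin n`. -/
def cnext {n : ℕ} (i : Fin n) : Fin n := ⟨((i : ℕ) + 1) % n, Nat.mod_lt _ i.pos⟩

/-- The box of a local deterministic strategy `s`, as a vector indexed by pairs
`(a, x)` of output and input bit strings: `P_s(a|x) = ∏_i [a_i = s_i(x_i)]`. -/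
def stratBox {n : ℕ} (s : Fin n → Fin 2 → Fin 2) :
    (Fin n → Fin 2) × (Fin n → Fin 2) → ℝ :=
  fun ax => ∏ i, if ax.1 i = s i (ax.2 i) then 1 else 0

/-- Even parity of a bit string: `x₁ ⊕ ⋯ ⊕ x_n = 0`. -/
def parity0 {n : ℕ} (x : Fin n → Fin 2) : Prop := (∑ i, (x i : ℕ)) % 2 = 0

/-- A strategy `s` saturates the GYNI_n inequality (for odd `n`) iff there is a bit string
`x` of even parity with `x_{i+1} = s_i(x_i)` for all `i` (indices cyclic). -/
def Saturates {n : ℕ} (s : Fin n → Fin 2 → Fin 2) : Prop :=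
  ∃ x : Fin n → Fin 2, parity0 x ∧ ∀ i, x (cnext i) = s i (x i)

/-- The constant strategy associated to a bit string `c`. -/
def constStrat {n : ℕ} (c : Fin n → Fin 2) : Fin n → Fin 2 → Fin 2 := fun j _ => c j

lemma cnext_injective {n : ℕ} : Function.Injective (cnext (n := n)) := by
  intro i j h
  have hi := i.isLt
  have hj := j.isLt
  simp only [cnext, Fin.mk.injEq] at h
  ext
  rcases Nat.lt_or_ge (i + 1) n with h1 | h1 <;> rcases Nat.lt_or_ge (j + 1) n with h2 | h2
  · rw [Nat.mod_eq_of_lt h1, Nat.mod_eq_of_lt h2] at h; omega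
  · have : (j : ℕ) + 1 = n := by omega
    rw [Nat.mod_eq_of_lt h1, this, Nat.mod_self] at h; omega
  · have : (i : ℕ) + 1 = n := by omega
    rw [Nat.mod_eq_of_lt h2, this, Nat.mod_self] at h; omega
  · omega

lemma cnext_bijective {n : ℕ} : Function.Bijective (cnext (n := n)) :=
  Finite.injective_iff_bijective.mp cnext_injective

lemma cnext_ne {n : ℕ} (hn : 2 ≤ n) (i : Fin n) : cnext i ≠ i := by
  intro h
  have hi := i.isLt
  have h' := congrArg Fin.val h
  simp only [cnext] at h'
  rcases Nat.lt_or_ge (i + 1) n with h1 | h1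
  · rw [Nat.mod_eq_of_lt h1] at h'; omega
  · have : (i : ℕ) + 1 = n := by omega
    rw [this, Nat.mod_self] at h'; omega

lemma cnext_cnext_ne {n : ℕ} (hn : 3 ≤ n) (i : Fin n) : cnext (cnext i) ≠ i := by
  intro h
  have hi := i.isLt
  have h' := congrArg Fin.val h
  simp only [cnext, Nat.mod_add_mod] at h'
  rcases Nat.lt_or_ge (i + 1 + 1) n with h1 | h1
  · rw [Nat.mod_eq_of_lt h1] at h'; omega
  · rw [Nat.mod_eq_sub_mod h1, Nat.mod_eq_of_lt (by omega)] at h'; omega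

/-- Induction along the cycle, from an arbitrary starting index. -/
lemma cnext_induction {n : ℕ} {p : Fin n → Prop} {j : Fin n} (hj : p j)
    (step : ∀ i, p i → p (cnext i)) (k : Fin n) : p k := by
  have key : ∀ t : ℕ, p ⟨(j + t) % n, Nat.mod_lt _ j.pos⟩ := by
    intro t
    induction t with
    | zero => simpa [Nat.mod_eq_of_lt j.isLt] using hj
    | succ t ih => simpa [cnext, Nat.mod_add_mod, Nat.add_assoc] using step _ ih
  have h := key (n - j + k)
  have e : ((j : ℕ) + (n - j + k)) % n = k := by
    have := j.isLt
    rw [show (j : ℕ) + (n - j + k) = n + k by omega, Nat.add_mod_left, Nat.mod_eq_of_lt k.isLt]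
  simpa only [e] using h

lemma val_add_val_flip (b : Fin 2) : (b : ℕ) + ((1 + b : Fin 2) : ℕ) = 1 := by
  revert b; decide

lemma parity0_flip_all {n : ℕ} (hodd : Odd n) {c : Fin n → Fin 2} (hc : ¬ parity0 c) :
    parity0 (fun i => 1 + c i) := by
  have h : ∑ i, (c i : ℕ) + ∑ i, ((1 + c i : Fin 2) : ℕ) = n := by
    rw [← Finset.sum_add_distrib]
    simp [val_add_val_flip]
  obtain ⟨m, rfl⟩ := hodd
  unfold parity0 at *
  beta_reduce
  omega

lemma parity0_flip_one {n : ℕ} {c : Fin n → Fin 2} (hc : ¬ parity0 c) (j : Fin n) :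
    parity0 (Function.update c j (1 + c j)) := by
  have h1 := Finset.add_sum_erase Finset.univ (fun i => (c i : ℕ)) (Finset.mem_univ j)
  have h2 := Finset.add_sum_erase Finset.univ
    (fun i => (Function.update c j (1 + c j) i : ℕ)) (Finset.mem_univ j)
  have h3 : ∑ i ∈ Finset.univ.erase j, (Function.update c j (1 + c j) i : ℕ)
      = ∑ i ∈ Finset.univ.erase j, (c i : ℕ) :=
    Finset.sum_congr rfl fun i hi => by
      rw [Function.update_of_ne (Finset.ne_of_mem_erase hi)]
  have h4 := val_add_val_flip (c j)
  simp only [Function.update_self] at h2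
  unfold parity0 at *
  omega

lemma parity0_comp_perm {n : ℕ} (c : Fin n → Fin 2) (σ : Equiv.Perm (Fin n)) :
    parity0 (c ∘ σ) ↔ parity0 c := by
  unfold parity0
  rw [← Equiv.sum_comp σ (fun i => (c i : ℕ))]
  rfl

/-- Summing a box over a local map and its flip at party `j` erases the dependence on party `j`. -/
lemma stratBox_update_add_flip {n : ℕ} (s : Fin n → Fin 2 → Fin 2) (j : Fin n)
    (f : Fin 2 → Fin 2) :
    stratBox (Function.update s j f) + stratBox (Function.update s j (fun b => 1 + f b)) =
      fun ax => ∏ i ∈ Finset.univ.erase j, if ax.1 i = s i (ax.2 i) then 1 else 0 := by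
  have factor : ∀ (g : Fin 2 → Fin 2) (ax : (Fin n → Fin 2) × (Fin n → Fin 2)),
      stratBox (Function.update s j g) ax = (if ax.1 j = g (ax.2 j) then 1 else 0) *
        ∏ i ∈ Finset.univ.erase j, if ax.1 i = s i (ax.2 i) then (1 : ℝ) else 0 := by
    intro g ax
    unfold stratBox
    rw [← Finset.mul_prod_erase Finset.univ _ (Finset.mem_univ j), Function.update_self]
    congr 1
    exact Finset.prod_congr rfl fun i hi => by
      rw [Function.update_of_ne (Finset.ne_of_mem_erase hi)]
  have total : ∀ a b : Fin 2,
      (if a = b then (1 : ℝ) else 0) + (if a = 1 + b then 1 else 0) = 1 := by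
    intro a b
    fin_cases a <;> fin_cases b <;> simp
  funext ax
  rw [Pi.add_apply, factor, factor, ← add_mul, total, one_mul]

/-- The span of the boxes of the saturating strategies. -/
def satSpan (n : ℕ) : Submodule ℝ ((Fin n → Fin 2) × (Fin n → Fin 2) → ℝ) :=
  Submodule.span ℝ {v | ∃ u : Fin n → Fin 2 → Fin 2, Saturates u ∧ v = stratBox u}

/-- The class of the box of a strategy modulo the span of the saturating boxes. -/
def boxClass {n : ℕ} (s : Fin n → Fin 2 → Fin 2) :
    ((Fin n → Fin 2) × (Fin n → Fin 2) → ℝ) ⧸ satSpan n :=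
  (satSpan n).mkQ (stratBox s)

lemma boxClass_eq_zero {n : ℕ} {s : Fin n → Fin 2 → Fin 2} (hs : Saturates s) :
    boxClass s = 0 := by
  rw [boxClass, Submodule.mkQ_apply, Submodule.Quotient.mk_eq_zero]
  exact Submodule.subset_span ⟨s, hs, rfl⟩

lemma boxClass_update_eq {n : ℕ} (s : Fin n → Fin 2 → Fin 2) (j : Fin n) (f g : Fin 2 → Fin 2)
    (hf : Saturates (Function.update s j (fun b => 1 + f b)))
    (hg : Saturates (Function.update s j (fun b => 1 + g b))) :
    boxClass (Function.update s j f) = boxClass (Function.update s j g) := by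
  have h := congrArg (satSpan n).mkQ
    ((stratBox_update_add_flip s j f).trans (stratBox_update_add_flip s j g).symm)
  rw [map_add, map_add] at h
  change boxClass _ + boxClass _ = boxClass _ + boxClass _ at h
  rwa [boxClass_eq_zero hf, boxClass_eq_zero hg, add_zero, add_zero] at h

/-- A component followed by a constant one can be replaced by its output on the evaluation. -/
lemma boxClass_update_const {n : ℕ} (hn : 2 ≤ n) {s : Fin n → Fin 2 → Fin 2}
    {c : Fin n → Fin 2} (hc : ¬ parity0 c) (hs : ∀ i, c (cnext i) = s i (c i))
    {j : Fin n} (hj : ∀ b₁ b₂, s (cnext j) b₁ = s (cnext j) b₂) :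
    boxClass (Function.update s j fun _ => c (cnext j)) = boxClass s := by
  have sat : ∀ f : Fin 2 → Fin 2, f (c j) = c (cnext j) →
      Saturates (Function.update s j fun b => 1 + f b) := by
    intro f hf
    refine ⟨_, parity0_flip_one hc (cnext j), fun i => ?_⟩
    have hne := cnext_ne hn j
    rcases eq_or_ne i j with rfl | hij
    · rw [Function.update_self, Function.update_self, Function.update_of_ne hne.symm, hf]
    · rw [Function.update_of_ne (cnext_injective.ne hij), Function.update_of_ne hij, hs]
      rcases eq_or_ne i (cnext j) with rfl | h
      · exact hj _ _
      · rw [Function.update_of_ne h]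
  have h := boxClass_update_eq s j (fun _ => c (cnext j)) (s j) (sat _ rfl) (sat _ (hs j).symm)
  rwa [Function.update_eq_self] at h

lemma boxClass_eq_of_exists_const {n : ℕ} (hn : 2 ≤ n) {c : Fin n → Fin 2} (hc : ¬ parity0 c)
    (s : Fin n → Fin 2 → Fin 2) (hs : ∀ i, c (cnext i) = s i (c i))
    (hconst : ∃ k, ∀ b₁ b₂ : Fin 2, s k b₁ = s k b₂) :
    boxClass s = boxClass (constStrat (c ∘ cnext)) := by
  classical
  induction hN : (Finset.univ.filter fun j => ¬ ∀ b₁ b₂, s j b₁ = s j b₂).card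
    using Nat.strong_induction_on generalizing s with
  | _ N ih =>
  by_cases hall : ∀ j, ∀ b₁ b₂, s j b₁ = s j b₂
  · congr 1
    funext j b
    rw [hall j b (c j), ← hs]
    rfl
  · obtain ⟨k, hk⟩ := hconst
    obtain ⟨j₀, hj₀⟩ := not_forall.mp hall
    obtain ⟨j, hj, hj'⟩ :
        ∃ j, (¬ ∀ b₁ b₂, s j b₁ = s j b₂) ∧ ∀ b₁ b₂, s (cnext j) b₁ = s (cnext j) b₂ := by
      by_contra hno
      exact cnext_induction (p := fun j => ¬ ∀ b₁ b₂, s j b₁ = s j b₂) hj₀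
        (fun i hi hi' => hno ⟨i, hi, hi'⟩) k hk
    rw [← boxClass_update_const hn hc hs hj']
    refine ih _ ?_ _ (fun i => ?_) ⟨j, by simp⟩ rfl
    · rw [← hN]
      refine Finset.card_lt_card (Finset.ssubset_iff_of_subset ?_ |>.mpr ⟨j, ?_, ?_⟩)
      · intro i
        rcases eq_or_ne i j with rfl | hij
        · simp
        · simp [Function.update_of_ne hij]
      · exact Finset.mem_filter.mpr ⟨Finset.mem_univ _, hj⟩
      · simp
    · rcases eq_or_ne i j with rfl | hij
      · rw [Function.update_self]
      · rw [Function.update_of_ne hij, hs]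

/-- A strategy with flip-equivariant components, consistent with an odd string except at a single
index, is equivalent to the constant strategy of that string. -/
lemma boxClass_eq_of_single_violation {n : ℕ} (hn : 2 ≤ n) (hodd : Odd n) {c : Fin n → Fin 2}
    (hc : ¬ parity0 c) (T : Fin n → Fin 2 → Fin 2) (hT : ∀ i b, T i (1 + b) = 1 + T i b)
    (k : Fin n) (hk : 1 + T k (c k) = c (cnext k))
    (hs : ∀ i, i ≠ k → c (cnext i) = T i (c i)) :
    boxClass T = boxClass (constStrat (c ∘ cnext)) := by
  have sat : ∀ f : Fin 2 → Fin 2, f (1 + c k) = c (cnext k) →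
      Saturates (Function.update T k fun b => 1 + f b) := by
    intro f hf
    refine ⟨_, parity0_flip_all hodd hc, fun i => ?_⟩
    rcases eq_or_ne i k with rfl | hik
    · rw [Function.update_self, hf]
    · rw [Function.update_of_ne hik, hT, hs i hik]
  have h := boxClass_update_eq T k (T k) (fun _ => c (cnext k))
    (sat _ (by rw [hT, hk])) (sat _ rfl)
  rw [Function.update_eq_self] at h
  rw [h]
  refine boxClass_eq_of_exists_const hn hc _ (fun i => ?_) ⟨k, by simp⟩
  rcases eq_or_ne i k with rfl | hik
  · rw [Function.update_self]
  · rw [Function.update_of_ne hik, hs i hik]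

lemma boxClass_constStrat_swap {n : ℕ} (hn : 3 ≤ n) (hodd : Odd n) {c : Fin n → Fin 2}
    (hc : ¬ parity0 c) (j : Fin n) :
    boxClass (constStrat ((c ∘ Equiv.swap j (cnext j)) ∘ cnext)) =
      boxClass (constStrat (c ∘ cnext)) := by
  by_cases heq : c j = c (cnext j)
  · congr 2
    funext i
    simp only [Function.comp_apply, Equiv.swap_apply_def]
    split_ifs with h1 h2
    · rw [h1, heq]
    · rw [h2, heq]
    · rfl
  obtain ⟨k, rfl⟩ := cnext_bijective.2 j
  have cancel : ∀ a b : Fin 2, a + (a + b) = b := by decide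
  have cancel' : ∀ a b : Fin 2, 1 + (a + (a + b + 1)) = b := by decide
  have flip_add : ∀ a b : Fin 2, 1 + a + b = 1 + (a + b) := by decide
  have h1 : cnext k ≠ k := cnext_ne (by omega) k
  have h2 : cnext (cnext k) ≠ cnext k := cnext_ne (by omega) _
  have h3 : cnext (cnext k) ≠ k := cnext_cnext_ne hn k
  have h4 : cnext (cnext (cnext k)) ≠ cnext k := cnext_cnext_ne hn _
  have h5 : cnext (cnext (cnext k)) ≠ cnext (cnext k) := cnext_ne (by omega) _
  let T : Fin n → Fin 2 → Fin 2 :=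
    fun i b => b + (c i + c (cnext i) + if i = k then 1 else 0)
  have hT : ∀ i b, T i (1 + b) = 1 + T i b := fun i b => flip_add _ _
  rw [← boxClass_eq_of_single_violation (by omega) hodd hc T hT k
    (by simp [T, cancel']) (fun i hi => by simp [T, hi, cancel])]
  symm
  refine boxClass_eq_of_single_violation (by omega) hodd ((parity0_comp_perm _ _).not.mpr hc)
    T hT (cnext (cnext k)) ?_ fun i hi => ?_
  · simp only [Function.comp_apply, Equiv.swap_apply_right, Equiv.swap_apply_of_ne_of_ne h4 h5,
      T, if_neg h3]
    generalize c (cnext k) = x at *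
    generalize c (cnext (cnext k)) = y at *
    generalize c (cnext (cnext (cnext k))) = z at *
    revert x y z; decide
  · rcases eq_or_ne i k with rfl | hik
    · simp only [Function.comp_apply, Equiv.swap_apply_left,
        Equiv.swap_apply_of_ne_of_ne h1.symm h3.symm, T, if_true]
      generalize c (cnext i) = x at *
      generalize c (cnext (cnext i)) = y at *
      generalize c i = z at *
      revert x y z; decide
    · rcases eq_or_ne i (cnext k) with rfl | hik'
      · simp only [Function.comp_apply, Equiv.swap_apply_left, Equiv.swap_apply_right,
          T, if_neg h1]
        generalize c (cnext k) = x at *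
        generalize c (cnext (cnext k)) = y at *
        revert x y; decide
      · simp only [Function.comp_apply, Equiv.swap_apply_of_ne_of_ne hik' hi,
          Equiv.swap_apply_of_ne_of_ne (cnext_injective.ne hik) (cnext_injective.ne hik'),
          T, if_neg hik, add_zero, cancel]

lemma boxClass_constStrat_perm {n : ℕ} (hn : 3 ≤ n) (hodd : Odd n) (σ : Equiv.Perm (Fin n))
    {c : Fin n → Fin 2} (hc : ¬ parity0 c) :
    boxClass (constStrat ((c ∘ σ) ∘ cnext)) = boxClass (constStrat (c ∘ cnext)) := by
  obtain ⟨m, rfl⟩ : ∃ m, n = m + 1 := ⟨n - 1, by omega⟩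
  have hσ : σ ∈ Submonoid.closure
      (Set.range fun i : Fin m => Equiv.swap i.castSucc i.succ) := by
    rw [Equiv.Perm.mclosure_swap_castSucc_succ]; trivial
  induction hσ using Submonoid.closure_induction generalizing c with
  | mem τ hτ =>
    obtain ⟨i, rfl⟩ := hτ
    have hi : i.succ = cnext i.castSucc := by
      ext
      simp [cnext, Nat.mod_eq_of_lt]
    simp only [hi]
    exact boxClass_constStrat_swap hn hodd hc _
  | one => rfl
  | mul τ ρ _ _ hτ hρ =>
    rw [Equiv.Perm.coe_mul, ← Function.comp_assoc c,
      hρ ((parity0_comp_perm _ _).not.mpr hc), hτ hc]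

/-- For odd `n ≥ 3`, if a strategy `s` has at least one constant component
and does not saturate GYNI_n, and `s'` is its evaluation (the unique cyclically consistent
bit string), then `P_s − P_{[s']}` lies in the real linear span of the boxes of the
saturating strategies. -/
theorem stmt17 {n : ℕ} (hn : 3 ≤ n) (hodd : Odd n)
    (s : Fin n → Fin 2 → Fin 2)
    (hconst : ∃ k, ∀ b₁ b₂ : Fin 2, s k b₁ = s k b₂)
    (hnotsat : ¬ Saturates s)
    (s' : Fin n → Fin 2) (hs' : ∀ i, s' (cnext i) = s i (s' i)) :
    stratBox s - stratBox (constStrat s') ∈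
      Submodule.span ℝ
        {v | ∃ u : Fin n → Fin 2 → Fin 2, Saturates u ∧ v = stratBox u} := by
  have hc : ¬ parity0 s' := fun h => hnotsat ⟨s', h, hs'⟩
  let σ : Equiv.Perm (Fin n) := Equiv.ofBijective cnext cnext_bijective
  have hshift : (s' ∘ σ.symm) ∘ cnext = s' := funext fun i =>
    congrArg s' (σ.symm_apply_apply i)
  have h : boxClass s = boxClass (constStrat s') := by
    rw [boxClass_eq_of_exists_const (by omega) hc s hs' hconst,
      ← boxClass_constStrat_perm hn hodd σ.symm hc, hshift]
  exact (Submodule.Quotient.eq (satSpan n)).mp h
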